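/- DiagP(x) ∼ log x / log log x as x → ∞; that is, DiagP(x) · log log x / log x tends to 1 as x → ∞. -/

import Mathlib

open Real Filter

/-- `nthPrime n` is the `n`-th prime number, 1-indexed: `nthPrime 1 = 2`, `nthPrime 2 = 3`, … -/
noncomputable def nthPrime (n : ℕ) : ℕ := Nat.nth Nat.Prime (n - 1)

/-- `iterPrime n k` is the `k`-fold iterated prime `p_n^(k)`:
`iterPrime n 0 = n`, `iterPrime n 1 = p_n`, and `iterPrime n (k+1) = p_{iterPrime n k}`. -/
noncomputable def iterPrime (n : ℕ) : ℕ → ℕ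
  | 0 => n
  | k + 1 => nthPrime (iterPrime n k)

/-- The counting function `P_n^T(x) = #{k ≥ 1 : p_n^(k) ≤ x}`. -/
noncomputable def PnT (n : ℕ) (x : ℝ) : ℕ :=
  {k : ℕ | 1 ≤ k ∧ (iterPrime n k : ℝ) ≤ x}.ncard

/-- The counting function `DiagP(x) = #{k ≥ 1 : p_k^(k) ≤ x}`. -/
noncomputable def DiagP (x : ℝ) : ℕ :=
  {k : ℕ | 1 ≤ k ∧ (iterPrime k k : ℝ) ≤ x}.ncard

open scoped Topology

theorem succ_le_nthPrime (n : ℕ) : n + 1 ≤ nthPrime n := by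
  have := Nat.add_two_le_nth_prime (n - 1)
  unfold nthPrime
  omega

theorem nthPrime_mono : Monotone nthPrime := fun _ _ h =>
  Nat.nth_monotone Nat.infinite_setOfPred_prime (Nat.sub_le_sub_right h 1)

theorem iterPrime_mono (k : ℕ) : Monotone fun n => iterPrime n k := by
  induction k with
  | zero => exact monotone_id
  | succ k ih => exact nthPrime_mono.comp ih

theorem le_iterPrime (n k : ℕ) : n ≤ iterPrime n k := by
  induction k with
  | zero => exact le_rfl
  | succ k ih => exact ih.trans ((Nat.le_succ _).trans (succ_le_nthPrime _))

theorem iterPrime_diag_strictMono : StrictMono fun k => iterPrime k k :=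
  strictMono_nat_of_lt_succ fun k =>
    (iterPrime_mono k k.le_succ).trans_lt (succ_le_nthPrime (iterPrime (k + 1) k))

theorem iterPrime_diagP {x : ℝ} (hx : 0 ≤ x) :
    (iterPrime (DiagP x) (DiagP x) : ℝ) ≤ x ∧
      x < iterPrime (DiagP x + 1) (DiagP x + 1) := by
  classical
  have hex : ∃ m : ℕ, x < iterPrime m m := by
    obtain ⟨m, hm⟩ := exists_nat_gt x
    exact ⟨m, hm.trans_le (by exact_mod_cast le_iterPrime m m)⟩
  obtain ⟨m, hm⟩ : ∃ m, Nat.find hex = m + 1 := by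
    refine Nat.exists_eq_succ_of_ne_zero fun h => ?_
    have := Nat.find_spec hex
    rw [h] at this
    exact absurd this (by simpa [iterPrime] using hx)
  have hset : {k : ℕ | 1 ≤ k ∧ (iterPrime k k : ℝ) ≤ x} = Finset.Icc 1 m := by
    ext k
    simp only [Set.mem_ofPred_eq, Finset.coe_Icc, Set.mem_Icc, and_congr_right_iff]
    refine fun _ => ⟨fun h => ?_, fun h => ?_⟩
    · by_contra! hlt
      have h1 : iterPrime (m + 1) (m + 1) ≤ iterPrime k k :=
        iterPrime_diag_strictMono.monotone hlt
      have h2 := Nat.find_spec hex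
      rw [hm] at h2
      exact absurd (h2.trans_le (by exact_mod_cast h1)) h.not_gt
    · exact not_lt.1 (Nat.find_min hex (by omega))
  have hD : DiagP x = m := by
    rw [DiagP, hset, Set.ncard_coe_finset, Nat.card_Icc, Nat.add_sub_cancel]
  rw [hD]
  refine ⟨not_lt.1 (Nat.find_min hex (by omega)), ?_⟩
  rw [← hm]
  exact Nat.find_spec hex

theorem primeCounting_nthPrime {n : ℕ} (hn : 1 ≤ n) : Nat.primeCounting (nthPrime n) = n := by
  rw [nthPrime, Nat.primeCounting, Nat.primeCounting', Nat.count_succ,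
    Nat.count_nth_of_infinite Nat.infinite_setOfPred_prime, if_pos (Nat.prime_nth_prime _)]
  omega

theorem mul_log_le_nthPrime {n : ℕ} (hn : 1 ≤ n) :
    n * log n ≤ (2 * log 4 + 2) * nthPrime n := by
  set p := nthPrime n with hp
  have hnp : n + 1 ≤ p := succ_le_nthPrime n
  have hp1 : (1 : ℝ) < p := by exact_mod_cast (by omega : 1 < p)
  have hlog : 0 < log p := log_pos hp1
  have h := Chebyshev.pi_le_log4_mul_div hp1
  rw [Nat.floor_natCast, hp, primeCounting_nthPrime hn, ← hp, log_sqrt (by positivity)] at h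
  have hs : √(p : ℝ) * log p ≤ 2 * p := by
    have h1 : log √(p : ℝ) ≤ √(p : ℝ) := log_le_self (sqrt_nonneg _)
    rw [log_sqrt (by positivity)] at h1
    nlinarith [sqrt_nonneg (p : ℝ), mul_self_sqrt (by positivity : (0 : ℝ) ≤ p)]
  calc (n : ℝ) * log n ≤ n * log p := by
        gcongr
        omega
    _ ≤ (log 4 * p / (log p / 2) + √p) * log p := by gcongr
    _ = 2 * log 4 * p + √p * log p := by field_simp
    _ ≤ _ := by linarith

theorem eventually_nthPrime_le :
    ∃ C : ℝ, 0 < C ∧ ∀ᶠ n : ℕ in atTop, (nthPrime n : ℝ) ≤ C * (n * log n) := by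
  have hev : ∀ᶠ y : ℝ in atTop, log (y + 1) ≤ log 2 / 2 * y := by
    have h2 : 0 < log 2 / 4 := by have := log_pos one_lt_two; positivity
    have h := isLittleO_log_id_atTop.bound h2
    have h' := (tendsto_atTop_add_const_right atTop (1 : ℝ) tendsto_id).eventually h
    filter_upwards [h', eventually_ge_atTop 1] with y hy hy1
    simp only [id, norm_eq_abs] at hy
    rw [abs_of_nonneg (by linarith : (0 : ℝ) ≤ y + 1)] at hy
    nlinarith [le_abs_self (log (y + 1))]
  have hpt : Tendsto (fun n : ℕ => (nthPrime n : ℝ)) atTop atTop :=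
    tendsto_atTop_mono (fun n => by exact_mod_cast (Nat.le_succ n).trans (succ_le_nthPrime n))
      tendsto_natCast_atTop_atTop
  set c := 2 / log 2 with hc
  have hl2 := log_pos one_lt_two
  have hcpos : 0 < c := by positivity
  refine ⟨3 * c, by positivity, ?_⟩
  filter_upwards [hpt.eventually hev, eventually_ge_atTop 1,
    tendsto_natCast_atTop_atTop.eventually (eventually_ge_atTop (4 * c ^ 2))] with n hn hn1 hnc
  set p := nthPrime n with hp
  have hnp : n + 1 ≤ p := succ_le_nthPrime n
  have hp1 : (1 : ℝ) < p := by exact_mod_cast (by omega : 1 < p)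
  have hlog : 0 < log p := log_pos hp1
  have hn0 : (0 : ℝ) < n := by exact_mod_cast hn1
  have h := Chebyshev.pi_ge p
  rw [hp, primeCounting_nthPrime hn1, ← hp, div_le_iff₀ hlog] at h
  have h1 : (p : ℝ) ≤ c * (n * log p) := by
    rw [hc, div_mul_eq_mul_div, le_div_iff₀ hl2]
    linarith
  have h2 : √(p : ℝ) ≤ 2 * c * n := by
    have h3 : log √(p : ℝ) ≤ √(p : ℝ) := log_le_self (sqrt_nonneg _)
    rw [log_sqrt (by positivity)] at h3
    have hs : 0 < √(p : ℝ) := sqrt_pos.2 (by linarith)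
    have h4 : √(p : ℝ) * √p ≤ (2 * c * n) * √p := by
      rw [mul_self_sqrt (by positivity)]
      have : c * (n * log p) ≤ c * (n * (2 * √p)) := by gcongr; linarith
      linarith
    exact le_of_mul_le_mul_right h4 hs
  have h5 : (p : ℝ) ≤ (n : ℝ) ^ 3 := by
    have h6 : (p : ℝ) ≤ (2 * c * n) ^ 2 := by
      rw [← sq_sqrt (by positivity : (0 : ℝ) ≤ p)]
      gcongr
    have : 4 * c ^ 2 * (n : ℝ) ^ 2 ≤ n * n ^ 2 := by gcongr
    nlinarith
  have h7 : log p ≤ 3 * log n := by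
    have := log_le_log (by positivity) h5
    rwa [log_pow] at this
  calc (p : ℝ) ≤ c * (n * log p) := h1
    _ ≤ c * (n * (3 * log n)) := by gcongr
    _ = _ := by ring

/-- The Chebyshev estimate for the `n`-th prime, in logarithmic form. -/
theorem eventually_log_nthPrime_bounds :
    ∃ C : ℝ, 0 ≤ C ∧ ∀ᶠ n : ℕ in atTop,
      log n + log (log n) - C ≤ log (nthPrime n) ∧
        log (nthPrime n) ≤ log n + log (log n) + C := by
  obtain ⟨B, hB, hup⟩ := eventually_nthPrime_le
  have hA : 0 < 2 * log 4 + 2 := by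
    have : 0 < log 4 := log_pos (by norm_num)
    positivity
  refine ⟨max 0 (max (log (2 * log 4 + 2)) (log B)), le_max_left _ _, ?_⟩
  filter_upwards [hup, eventually_ge_atTop 2] with n hn hn2
  have hn1 : (1 : ℝ) < n := by exact_mod_cast hn2
  have hl : 0 < log n := log_pos hn1
  have hp : (0 : ℝ) < nthPrime n := by
    exact_mod_cast (Nat.succ_pos n).trans_le (succ_le_nthPrime n)
  have hlow := log_le_log (by positivity) (mul_log_le_nthPrime (by omega : 1 ≤ n))
  have hupp := log_le_log hp hn
  rw [log_mul (by positivity) hl.ne', log_mul hA.ne' hp.ne'] at hlow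
  rw [log_mul hB.ne' (by positivity), log_mul (by positivity) hl.ne'] at hupp
  have h1 := (le_max_left _ _).trans
    (le_max_right (0 : ℝ) (max (log (2 * log 4 + 2)) (log B)))
  have h2 := (le_max_right _ _).trans
    (le_max_right (0 : ℝ) (max (log (2 * log 4 + 2)) (log B)))
  constructor <;> linarith

theorem mul_log_sub_le_log_factorial (k : ℕ) : k * log k - k ≤ log (Nat.factorial k) := by
  rcases Nat.eq_zero_or_pos k with rfl | hk
  · simp
  have hk' : (0 : ℝ) < k := by exact_mod_cast hk
  have hf : (0 : ℝ) < Nat.factorial k := by exact_mod_cast Nat.factorial_pos k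
  have h := log_le_log (by positivity) (pow_div_factorial_le_exp (k : ℝ) hk'.le k)
  rw [log_div (by positivity) hf.ne', log_pow, log_exp] at h
  linarith

theorem tendsto_log_natCast : Tendsto (fun k : ℕ => log k) atTop atTop :=
  tendsto_log_atTop.comp tendsto_natCast_atTop_atTop

theorem eventually_le_log_iterPrime_diag :
    ∃ C : ℝ, ∀ᶠ k : ℕ in atTop, k * log k - C * k ≤ log (iterPrime k k) := by
  obtain ⟨C, hC, h⟩ := eventually_log_nthPrime_bounds
  obtain ⟨n₀, hn₀⟩ := eventually_atTop.1 h
  refine ⟨C + 1, ?_⟩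
  filter_upwards [eventually_ge_atTop n₀, eventually_ge_atTop 1,
    tendsto_log_natCast.eventually (eventually_ge_atTop (exp (C + 1)))] with k hk hk1 hkl
  have hstep (j : ℕ) := (hn₀ (iterPrime k j) (hk.trans (le_iterPrime k j))).1
  have hbase (j : ℕ) : exp (C + 1) ≤ log (iterPrime k j) :=
    hkl.trans (log_le_log (by exact_mod_cast hk1) (by exact_mod_cast le_iterPrime k j))
  have hlin (j : ℕ) : (j : ℝ) + 1 ≤ log (iterPrime k j) := by
    induction j with
    | zero =>
      have := add_one_le_exp (C + 1)
      have := hbase 0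
      push_cast
      linarith
    | succ j ih =>
      have h1 := hstep j
      have h2 : C + 1 ≤ log (log (iterPrime k j)) := by
        rw [le_log_iff_exp_le ((exp_pos _).trans_le (hbase j))]
        exact hbase j
      rw [iterPrime]
      push_cast
      linarith
  have hfac (j : ℕ) : log (Nat.factorial j) - C * j ≤ log (iterPrime k j) := by
    induction j with
    | zero =>
      have := hlin 0
      simp only [Nat.factorial_zero, Nat.cast_one, log_one, CharP.cast_eq_zero] at *
      linarith
    | succ j ih =>
      have h1 := hstep j
      have h2 := log_le_log (by positivity) (hlin j)
      have hf : (Nat.factorial j : ℝ) ≠ 0 := by exact_mod_cast Nat.factorial_ne_zero j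
      rw [iterPrime, Nat.factorial_succ, Nat.cast_mul, log_mul (by positivity) hf]
      push_cast
      linarith
  linarith [hfac k, mul_log_sub_le_log_factorial k]

theorem tendsto_log_log_div_log : Tendsto (fun k : ℕ => log (log k) / log k) atTop (𝓝 0) :=
  (isLittleO_log_id_atTop.tendsto_div_nhds_zero).comp tendsto_log_natCast

theorem tendsto_upper_div (C : ℝ) :
    Tendsto (fun k : ℕ => (log k + k * (log k + 2 * log (log k) + C)) / (k * log k))
      atTop (𝓝 1) := by
  have h : Tendsto (fun k : ℕ => (k : ℝ)⁻¹ + 1 + 2 * (log (log k) / log k) + C * (log k)⁻¹)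
      atTop (𝓝 (0 + 1 + 2 * 0 + C * 0)) :=
    (((tendsto_inv_atTop_nhds_zero_nat).add_const 1).add
      (tendsto_log_log_div_log.const_mul 2)).add
        ((tendsto_inv_atTop_zero.comp tendsto_log_natCast).const_mul C)
  simp only [zero_add, mul_zero, add_zero] at h
  refine h.congr' ?_
  filter_upwards [eventually_ge_atTop 2] with k hk
  have hk0 : (k : ℝ) ≠ 0 := by positivity
  have hl : log k ≠ 0 := (log_pos (by exact_mod_cast hk)).ne'
  field_simp
  ring

theorem eventually_log_iterPrime_diag_le :
    ∃ C : ℝ, ∀ᶠ k : ℕ in atTop,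
      log (iterPrime k k) ≤ log k + k * (log k + 2 * log (log k) + C) := by
  obtain ⟨C, hC, h⟩ := eventually_log_nthPrime_bounds
  obtain ⟨n₀, hn₀⟩ := eventually_atTop.1 h
  refine ⟨C, ?_⟩
  filter_upwards [eventually_ge_atTop n₀, eventually_ge_atTop 2,
    tendsto_log_natCast.eventually (eventually_ge_atTop 2),
    (tendsto_upper_div C).eventually (eventually_le_nhds one_lt_two)] with k hk hk2 hkl hU
  have hk0 : (0 : ℝ) < k := by positivity
  have hl : 0 < log k := by linarith
  have hll : 0 ≤ log (log k) := log_nonneg (by linarith)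
  rw [div_le_iff₀ (by positivity)] at hU
  have hstep (j : ℕ) := (hn₀ (iterPrime k j) (hk.trans (le_iterPrime k j))).2
  have key (j : ℕ) (hj : j ≤ k) :
      log (iterPrime k j) ≤ log k + j * (log k + 2 * log (log k) + C) := by
    induction j with
    | zero => simp [iterPrime]
    | succ j ih =>
      have ih := ih (by omega)
      have hjk : (j : ℝ) ≤ k := by exact_mod_cast (by omega : j ≤ k)
      have hpos : 0 < log (iterPrime k j) :=
        hl.trans_le (log_le_log hk0 (by exact_mod_cast le_iterPrime k j))
      have h1 : log (iterPrime k j) ≤ k * log k ^ 2 := by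
        have : (j : ℝ) * (log k + 2 * log (log k) + C) ≤ k * (log k + 2 * log (log k) + C) := by
          gcongr
        have : 2 * (k * log k) ≤ log k * (k * log k) := by gcongr
        nlinarith
      have h2 := log_le_log hpos h1
      rw [log_mul hk0.ne' (by positivity), log_pow] at h2
      have h3 := hstep j
      rw [iterPrime]
      push_cast at *
      linarith
  exact key k le_rfl

theorem tendsto_log_iterPrime_diag_div :
    Tendsto (fun k : ℕ => log (iterPrime k k) / (k * log k)) atTop (𝓝 1) := by
  obtain ⟨A, hA⟩ := eventually_le_log_iterPrime_diag
  obtain ⟨B, hB⟩ := eventually_log_iterPrime_diag_le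
  have hlow : Tendsto (fun k : ℕ => 1 - A * (log k)⁻¹) atTop (𝓝 1) := by
    simpa using ((tendsto_inv_atTop_zero.comp tendsto_log_natCast).const_mul A).const_sub 1
  refine tendsto_of_tendsto_of_tendsto_of_le_of_le' hlow (tendsto_upper_div B) ?_ ?_
  · filter_upwards [hA, eventually_ge_atTop 2] with k hk hk2
    have hk0 : (0 : ℝ) < k := by positivity
    have hl : 0 < log k := log_pos (by exact_mod_cast hk2)
    rw [le_div_iff₀ (by positivity)]
    refine le_trans (le_of_eq ?_) hk
    field_simp
  · filter_upwards [hB, eventually_ge_atTop 2] with k hk hk2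
    gcongr

theorem tendsto_succ_mul_log_div :
    Tendsto (fun k : ℕ => ((k + 1 : ℕ) : ℝ) * log (k + 1 : ℕ) / (k * log k)) atTop (𝓝 1) := by
  have h1 : Tendsto (fun k : ℕ => 1 + (k : ℝ)⁻¹) atTop (𝓝 1) := by
    simpa using tendsto_inv_atTop_nhds_zero_nat.const_add (1 : ℝ)
  have h2 : Tendsto (fun k : ℕ => 1 + log (1 + (k : ℝ)⁻¹) * (log k)⁻¹) atTop (𝓝 1) := by
    simpa using ((h1.log one_ne_zero).mul
      (tendsto_inv_atTop_zero.comp tendsto_log_natCast)).const_add 1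
  have h := h1.mul h2
  rw [mul_one] at h
  refine h.congr' ?_
  filter_upwards [eventually_ge_atTop 2] with k hk
  have hk0 : (0 : ℝ) < k := by positivity
  have hl : log k ≠ 0 := (log_pos (by exact_mod_cast hk)).ne'
  have he : ((k + 1 : ℕ) : ℝ) = k * (1 + (k : ℝ)⁻¹) := by
    push_cast
    field_simp
  rw [he, log_mul hk0.ne' (by positivity)]
  field_simp

theorem tendsto_diagP : Tendsto DiagP atTop atTop := by
  refine tendsto_atTop.2 fun b => ?_
  filter_upwards [eventually_ge_atTop (0 : ℝ), eventually_ge_atTop (iterPrime b b : ℝ)]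
    with x hx hb
  by_contra! hlt
  have h : iterPrime (DiagP x + 1) (DiagP x + 1) ≤ iterPrime b b :=
    iterPrime_diag_strictMono.monotone hlt
  exact absurd ((iterPrime_diagP hx).2.trans_le (by exact_mod_cast h)) hb.not_gt

theorem tendsto_log_div_diagP :
    Tendsto (fun x : ℝ => log x / (DiagP x * log (DiagP x))) atTop (𝓝 1) := by
  have hlow := tendsto_log_iterPrime_diag_div.comp tendsto_diagP
  have hup := (((tendsto_log_iterPrime_diag_div.comp (tendsto_add_atTop_nat 1)).mul
    tendsto_succ_mul_log_div).comp tendsto_diagP)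
  rw [mul_one] at hup
  refine tendsto_of_tendsto_of_tendsto_of_le_of_le' hlow hup ?_ ?_ <;>
  filter_upwards [eventually_gt_atTop (0 : ℝ), tendsto_diagP.eventually (eventually_ge_atTop 2)]
    with x hx hN <;>
  have hl : 0 < log (DiagP x) := log_pos (by exact_mod_cast hN) <;>
  have hN0 : (0 : ℝ) < DiagP x := by positivity
  · have hpos : 0 < iterPrime (DiagP x) (DiagP x) := by
      have := le_iterPrime (DiagP x) (DiagP x)
      omega
    simp only [Function.comp]
    gcongr
    exact (iterPrime_diagP hx.le).1
  · have hl' : 0 < log ((DiagP x + 1 : ℕ) : ℝ) := log_pos (by exact_mod_cast (by omega))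
    simp only [Function.comp]
    rw [div_mul_div_cancel₀ (by positivity)]
    gcongr
    exact (iterPrime_diagP hx.le).2.le

theorem diagP_asymp :
    Filter.Tendsto (fun x : ℝ => (DiagP x : ℝ) * Real.log (Real.log x) / Real.log x)
      Filter.atTop (nhds 1) := by
  have hq := tendsto_log_div_diagP
  have hN := tendsto_log_natCast.comp tendsto_diagP
  have hr : Tendsto (fun x : ℝ => 1 + log (log (DiagP x)) / log (DiagP x) +
      log (log x / (DiagP x * log (DiagP x))) * (log (DiagP x))⁻¹) atTop (𝓝 1) := by
    simpa using ((tendsto_log_log_div_log.comp tendsto_diagP).const_add 1).add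
      ((hq.log one_ne_zero).mul (tendsto_inv_atTop_zero.comp hN))
  have h := hr.div hq one_ne_zero
  rw [div_one] at h
  refine h.congr' ?_
  filter_upwards [eventually_gt_atTop (1 : ℝ), tendsto_diagP.eventually (eventually_ge_atTop 2)]
    with x hx hN2
  have hx0 : 0 < log x := log_pos hx
  have hl : 0 < log (DiagP x) := log_pos (by exact_mod_cast hN2)
  have hN0 : (0 : ℝ) < DiagP x := by positivity
  simp only [Pi.div_apply]
  rw [log_div hx0.ne' (by positivity), log_mul hN0.ne' hl.ne']
  field_simp
  ring
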